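/- Let μ > 0 and c > 0, and let X be a random variable with the exponential distribution of rate μ (density μe^{−μx} on [0,∞)). Define T = c/(2X) + X/2. Then T ≥ √c almost surely, and for every y ≥ √c, P(T ≤ y) = exp(−μ(y − √(y² − c))) − exp(−μ(y + √(y² − c))). -/

import Mathlib

open MeasureTheory ProbabilityTheory Real Set

namespace ProbabilityTheory

lemma nullSingletonClass_expMeasure (r : ℝ) : NullSingletonClass (expMeasure r) := by
  refine ⟨fun x ↦ ?_⟩
  unfold expMeasure gammaMeasure
  exact withDensity_absolutelyContinuous _ _ (measure_singleton x)

lemma measureReal_expMeasure_Iic {r x : ℝ} (hr : 0 < r) (hx : 0 ≤ x) :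
    (expMeasure r).real (Iic x) = 1 - exp (-(r * x)) := by
  have := isProbabilityMeasure_expMeasure hr
  rw [← cdf_eq_real, cdf_expMeasure_eq hr, if_pos hx]

lemma ae_pos_expMeasure {r : ℝ} (hr : 0 < r) : ∀ᵐ x ∂expMeasure r, 0 < x := by
  have := isProbabilityMeasure_expMeasure hr
  have h : (expMeasure r).real (Iic 0) = 0 := by
    simp [measureReal_expMeasure_Iic hr le_rfl]
  rw [measureReal_eq_zero_iff] at h
  simpa [ae_iff, Iic] using h

lemma measureReal_expMeasure_Icc {r a b : ℝ} (hr : 0 < r) (ha : 0 ≤ a) (hab : a ≤ b) :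
    (expMeasure r).real (Icc a b) = exp (-(r * a)) - exp (-(r * b)) := by
  have := isProbabilityMeasure_expMeasure hr
  have := nullSingletonClass_expMeasure r
  rw [← measureReal_congr Ioc_ae_eq_Icc, ← Iic_sdiff_Iic,
    measureReal_sdiff (Iic_subset_Iic.2 hab) measurableSet_Iic,
    measureReal_expMeasure_Iic hr ha, measureReal_expMeasure_Iic hr (ha.trans hab)]
  ring

end ProbabilityTheory

lemma sqrt_le_div_two_mul_add_half {c x : ℝ} (hc : 0 ≤ c) (hx : 0 < x) :
    √c ≤ c / (2 * x) + x / 2 := by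
  have h : c / (2 * x) + x / 2 - √c = (√c - x) ^ 2 / (2 * x) := by
    field_simp
    linear_combination -(sq_sqrt hc)
  have : 0 ≤ (√c - x) ^ 2 / (2 * x) := by positivity
  linarith

lemma div_two_mul_add_half_le_iff {c x y : ℝ} (hx : 0 < x) (hy : c ≤ y ^ 2) :
    c / (2 * x) + x / 2 ≤ y ↔ x ∈ Icc (y - √(y ^ 2 - c)) (y + √(y ^ 2 - c)) := by
  have h : c / (2 * x) + x / 2 - y = ((x - y) ^ 2 - (y ^ 2 - c)) / (2 * x) := by
    field_simp
    ring
  rw [← sub_nonpos, h, div_le_iff₀ (by positivity), zero_mul, sub_nonpos,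
    Real.sq_le (sub_nonneg.2 hy), mem_Icc]
  constructor <;> rintro ⟨h1, h2⟩ <;> constructor <;> linarith

/-- Appendix A: the distance `T = c/(2X) + X/2` from the top-side base station to the
top-to-bottom handover point (with `X` exponential of rate `μ`) satisfies `T ≥ √c`
almost surely and has CDF
`P(T ≤ y) = exp (-μ (y - √(y² - c))) - exp (-μ (y + √(y² - c)))` for `y ≥ √c`. -/
theorem handover_distance_top_cdf
    (mu c : ℝ) (hmu : 0 < mu) (hc : 0 < c)
    (Ω : Type*) [MeasurableSpace Ω] (P : Measure Ω) [IsProbabilityMeasure P]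
    (X : Ω → ℝ) (hX : Measurable X)
    (hXlaw : P.map X = ProbabilityTheory.expMeasure mu) :
    (∀ᵐ ω ∂P, Real.sqrt c ≤ c / (2 * X ω) + X ω / 2)
    ∧
    (∀ y : ℝ, Real.sqrt c ≤ y →
      (P {ω | c / (2 * X ω) + X ω / 2 ≤ y}).toReal
        = Real.exp (-mu * (y - Real.sqrt (y ^ 2 - c)))
          - Real.exp (-mu * (y + Real.sqrt (y ^ 2 - c)))) := by
  have hpos : ∀ᵐ ω ∂P, 0 < X ω :=
    ae_of_ae_map hX.aemeasurable (hXlaw ▸ ae_pos_expMeasure hmu)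
  refine ⟨hpos.mono fun ω hω ↦ sqrt_le_div_two_mul_add_half hc.le hω, fun y hy ↦ ?_⟩
  have hy0 : 0 ≤ y := (sqrt_nonneg c).trans hy
  have hcy : c ≤ y ^ 2 := (Real.sqrt_le_left hy0).1 hy
  have hs : √(y ^ 2 - c) ≤ y := (Real.sqrt_le_left hy0).2 (by linarith)
  have hs0 := sqrt_nonneg (y ^ 2 - c)
  have hset : {ω | c / (2 * X ω) + X ω / 2 ≤ y} =ᵐ[P]
      X ⁻¹' Icc (y - √(y ^ 2 - c)) (y + √(y ^ 2 - c)) := by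
    filter_upwards [hpos] with ω hω
    exact propext (div_two_mul_add_half_le_iff hω hcy)
  rw [measure_congr hset, ← Measure.map_apply hX measurableSet_Icc, hXlaw, ← measureReal_def,
    measureReal_expMeasure_Icc hmu (by linarith) (by linarith), neg_mul, neg_mul]
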